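/- Let b be a nonnegative real-valued random variable on a probability space, ρ : [0,∞) → [0,∞) continuous, bounded, and strictly decreasing with ρ(x) → 0 as x → ∞, and Δ > 0. Define ζ = 0 if E[ρ(b)] < Δ, and otherwise ζ = ξ(Δ), the unique ξ ≥ 0 with E[ρ(ξ + b)] = Δ. Then ζ is the minimum of the set { z ≥ 0 : E[ρ(z + b)] ≤ Δ }; that is, E[ρ(ζ + b)] ≤ Δ, and every z ≥ 0 with E[ρ(z + b)] ≤ Δ satisfies z ≥ ζ. -/

import Mathlib

open MeasureTheory Filter Set

/-- **The optimal post-sampling waiting time is the least feasible one.**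
Let `b` be a nonnegative real random variable (the channel busy time), let
`ρ : [0,∞) → [0,∞)` be continuous, bounded, and strictly decreasing with `ρ(x) → 0` as
`x → ∞`, and let `Δ > 0` be the leakage budget.  Define `ζ = 0` if `E[ρ(b)] < Δ`, and
otherwise let `ζ = ξ(Δ)` be the unique `ξ ≥ 0` with `E[ρ(ξ + b)] = Δ`.  Then `ζ` is the
minimum of the feasible set `{z ≥ 0 : E[ρ(z + b)] ≤ Δ}`: it is feasible, and every feasible
`z ≥ 0` satisfies `z ≥ ζ`. -/
theorem optimal_post_sampling_wait_isLeast
    {Ω : Type*} [MeasurableSpace Ω] (P : Measure Ω) [IsProbabilityMeasure P]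
    (b : Ω → ℝ) (hbmeas : Measurable b) (hbnonneg : ∀ ω, 0 ≤ b ω)
    (ρ : ℝ → ℝ)
    (hρcont : ContinuousOn ρ (Ici 0))
    (hρnonneg : ∀ x ∈ Ici (0 : ℝ), 0 ≤ ρ x)
    (hρbdd : ∃ C, ∀ x ∈ Ici (0 : ℝ), ρ x ≤ C)
    (hρanti : StrictAntiOn ρ (Ici 0))
    (hρlim : Tendsto ρ atTop (nhds 0))
    (Δ : ℝ) (hΔpos : 0 < Δ)
    (ζ : ℝ)
    (hζ₀ : (∫ ω, ρ (b ω) ∂P) < Δ → ζ = 0)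
    (hζ₁ : Δ ≤ (∫ ω, ρ (b ω) ∂P) → 0 ≤ ζ ∧ ∫ ω, ρ (ζ + b ω) ∂P = Δ) :
    IsLeast {z : ℝ | 0 ≤ z ∧ ∫ ω, ρ (z + b ω) ∂P ≤ Δ} ζ := by
  obtain ⟨C, hC⟩ := hρbdd
  have hint : ∀ z : ℝ, 0 ≤ z → Integrable (fun ω => ρ (z + b ω)) P := by
    intro z hz
    have hnn : ∀ ω, 0 ≤ z + b ω := fun ω => add_nonneg hz (hbnonneg ω)
    have hc : Continuous (fun x : ℝ => ρ (max x 0)) :=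
      hρcont.comp_continuous (by fun_prop) (fun x => le_max_right x 0)
    have hm : Measurable (fun ω => ρ (max (z + b ω) 0)) :=
      hc.measurable.comp (measurable_const.add hbmeas)
    have he : (fun ω => ρ (max (z + b ω) 0)) = fun ω => ρ (z + b ω) := by
      funext ω
      rw [max_eq_left (hnn ω)]
    rw [he] at hm
    refine Integrable.of_bound hm.aestronglyMeasurable C (Eventually.of_forall fun ω => ?_)
    rw [Real.norm_of_nonneg (hρnonneg _ (hnn ω))]
    exact hC _ (hnn ω)
  rcases lt_or_ge (∫ ω, ρ (b ω) ∂P) Δ with h | h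
  · obtain rfl := hζ₀ h
    exact ⟨⟨le_rfl, by simpa using h.le⟩, fun z hz => hz.1⟩
  · obtain ⟨h0, h1⟩ := hζ₁ h
    refine ⟨⟨h0, h1.le⟩, ?_⟩
    rintro z ⟨hz0, hz⟩
    by_contra! hlt
    have hpt : ∀ ω, ρ (ζ + b ω) < ρ (z + b ω) := fun ω =>
      hρanti (add_nonneg hz0 (hbnonneg ω)) (add_nonneg h0 (hbnonneg ω)) (by linarith)
    have hpos : 0 < ∫ ω, (ρ (z + b ω) - ρ (ζ + b ω)) ∂P := by
      rw [integral_pos_iff_support_of_nonneg (fun ω => (sub_pos.2 (hpt ω)).le)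
        ((hint z hz0).sub (hint ζ h0))]
      have : Function.support (fun ω => ρ (z + b ω) - ρ (ζ + b ω)) = univ :=
        eq_univ_of_forall fun ω => (sub_pos.2 (hpt ω)).ne'
      rw [this]
      simp
    rw [integral_sub (hint z hz0) (hint ζ h0)] at hpos
    linarith
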